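/- arXiv:1711.04747 — 2 statements merged into one kernel-verified Lean document; each statement's English description precedes it below -/
import Mathlib

section
/- For every n ≥ 0, the number of staircase tableaux of size n+1 equals 4·(n+1) times the number of staircase tableaux of size n. -/
open MvPolynomial Finset

noncomputable section

/-- The polynomial ring `ℚ[α,β,γ,δ,q,u]`: variables `0,1,2,3,4,5` are `α,β,γ,δ,q,u`. -/
abbrev P6 : Type := MvPolynomial (Fin 6) ℚ

/-- A staircase tableau of size `n` is an assignment, to each cell `(i,j)` with `j ≤ i`
(indices `0`-based here, rows numbered bottom to top, columns left to right), of either the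
empty label (`none`) or one of the four symbols `α,β,γ,δ` (`some 0, some 1, some 2, some 3`),
such that every diagonal cell is non-empty, the cells above an `α/γ` in its column are empty,
and the cells to the left of a `β/δ` in its row are empty.  Cells outside the staircase
(`i < j`) carry `none`. -/
def IsStaircase (n : ℕ) (T : Fin n → Fin n → Option (Fin 4)) : Prop :=
  (∀ i j : Fin n, i < j → T i j = none) ∧
  (∀ i : Fin n, T i i ≠ none) ∧
  (∀ i j i' : Fin n, j ≤ i → i < i' → (T i j = some 0 ∨ T i j = some 2) → T i' j = none) ∧
  (∀ i j j' : Fin n, j' < j → j ≤ i → (T i j = some 1 ∨ T i j = some 3) → T i j' = none)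

instance IsStaircase.decPred (n : ℕ) : DecidablePred (IsStaircase n) := fun _ =>
  @instDecidableAnd _ _ inferInstance
    (@instDecidableAnd _ _ inferInstance (@instDecidableAnd _ _ inferInstance inferInstance))

/-- The type of staircase tableaux of size `n`. -/
def StaircaseTableau (n : ℕ) : Type := {T : Fin n → Fin n → Option (Fin 4) // IsStaircase n T}

instance (n : ℕ) : Fintype (StaircaseTableau n) := Subtype.fintype _

/-- The label of the nearest non-empty cell to the right of the cell `(i,j)` in its row
(`none` if there is no such cell). -/
def nearestRight (n : ℕ) (T : Fin n → Fin n → Option (Fin 4)) (i j : Fin n) :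
    Option (Fin 4) :=
  if h : (univ.filter fun j' : Fin n => j < j' ∧ T i j' ≠ none).Nonempty then
    T i ((univ.filter fun j' : Fin n => j < j' ∧ T i j' ≠ none).min' h)
  else none

/-- The label of the nearest non-empty cell below the cell `(i,j)` in its column
(`none` if there is no such cell). -/
def nearestBelow (n : ℕ) (T : Fin n → Fin n → Option (Fin 4)) (i j : Fin n) :
    Option (Fin 4) :=
  if h : (univ.filter fun i' : Fin n => i' < i ∧ T i' j ≠ none).Nonempty then
    T ((univ.filter fun i' : Fin n => i' < i ∧ T i' j ≠ none).max' h) j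
  else none

/-- The condition for an empty cell to receive a `q` in the `q/u` filling: the nearest
non-empty cell to its right contains a `δ`, or the nearest non-empty cell to its right
contains an `α` or a `γ` and the nearest non-empty cell below it contains a `β` or a `γ`. -/
def QCell (n : ℕ) (T : Fin n → Fin n → Option (Fin 4)) (i j : Fin n) : Prop :=
  nearestRight n T i j = some 3 ∨
    ((nearestRight n T i j = some 0 ∨ nearestRight n T i j = some 2) ∧
      (nearestBelow n T i j = some 1 ∨ nearestBelow n T i j = some 2))

instance (n : ℕ) (T : Fin n → Fin n → Option (Fin 4)) (i j : Fin n) :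
    Decidable (QCell n T i j) := by
  unfold QCell; infer_instance

/-- The label is `α` or `γ`, so the cells above it are empty. -/
abbrev BlocksColumn (c : Option (Fin 4)) : Prop := c = some 0 ∨ c = some 2

/-- The label is `β` or `δ`, so the cells to its left are empty. -/
abbrev BlocksRow (c : Option (Fin 4)) : Prop := c = some 1 ∨ c = some 3

/-- A row of labels which is supported on the open columns (those with `o j = true`) and in which
the cells to the left of a `β/δ` are empty. -/
def IsAdmissibleRow {m : ℕ} (o : Fin m → Bool) (r : Fin m → Option (Fin 4)) : Prop :=
  (∀ j, o j = false → r j = none) ∧ ∀ j j', j' < j → BlocksRow (r j) → r j' = none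

instance {m : ℕ} (o : Fin m → Bool) : DecidablePred (IsAdmissibleRow o) := fun _ =>
  @instDecidableAnd _ _ inferInstance inferInstance

/-- The weight `x` if the column is open and stays so after adding the label `c`. -/
def columnWeight (x : ℕ) (b : Bool) (c : Option (Fin 4)) : ℕ :=
  if b ∧ ¬ BlocksColumn c then x else 1

/-- The sum, over all admissible rows, of `x` to the number of columns that remain open. -/
def rowSum (x : ℕ) {m : ℕ} (o : Fin m → Bool) : ℕ :=
  ∑ r : Fin m → Option (Fin 4), if IsAdmissibleRow o r then ∏ j, columnWeight x (o j) (r j) else 0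

theorem isAdmissibleRow_snoc {m : ℕ} (o : Fin (m + 1) → Bool) (r : Fin m → Option (Fin 4))
    (c : Option (Fin 4)) :
    IsAdmissibleRow o (Fin.snoc r c : Fin (m + 1) → Option (Fin 4)) ↔
      (o (Fin.last m) = false → c = none) ∧ IsAdmissibleRow (fun j => o j.castSucc) r ∧
        (BlocksRow c → r = fun _ => none) := by
  constructor
  · rintro ⟨h₁, h₂⟩
    refine ⟨fun h => by simpa using h₁ _ h, ⟨fun j h => by simpa using h₁ j.castSucc h,
      fun j j' hj hb => ?_⟩, fun hb => funext fun j => ?_⟩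
    · simpa using h₂ j.castSucc j'.castSucc (by simpa using hj) (by simpa using hb)
    · simpa using h₂ (Fin.last m) j.castSucc (Fin.castSucc_lt_last j) (by simpa using hb)
  · rintro ⟨h₁, ⟨h₂, h₃⟩, h₄⟩
    refine ⟨fun j => ?_, fun j j' hj => ?_⟩
    · refine Fin.lastCases ?_ (fun j => ?_) j
      · simpa using h₁
      · simpa using h₂ j
    · induction j using Fin.lastCases with
      | last =>
        induction j' using Fin.lastCases with
        | last => simp at hj
        | cast j' => intro hb; simpa using congrFun (h₄ (by simpa using hb)) j'
      | cast j =>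
        induction j' using Fin.lastCases with
        | last => exact absurd hj (Fin.castSucc_lt_last j).not_gt
        | cast j' => simpa using h₃ j j' (by simpa using hj)

theorem sum_snoc {m : ℕ} (f : (Fin (m + 1) → Option (Fin 4)) → ℕ) :
    ∑ r, f r = ∑ c, ∑ r : Fin m → Option (Fin 4), f (Fin.snoc r c) := by
  rw [← (Fin.snocEquiv fun _ : Fin (m + 1) => Option (Fin 4)).sum_comp, Fintype.sum_prod_type]
  rfl

theorem isAdmissibleRow_none {m : ℕ} (o : Fin m → Bool) : IsAdmissibleRow o fun _ => none := by
  simp [IsAdmissibleRow]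

/-- The part of the sum over admissible rows coming from the label `c` in the last column. -/
theorem sum_snoc_admissible (x : ℕ) {m : ℕ} (o : Fin (m + 1) → Bool) (c : Option (Fin 4)) :
    (∑ r : Fin m → Option (Fin 4),
      if IsAdmissibleRow o (Fin.snoc r c : Fin (m + 1) → Option (Fin 4)) then
        ∏ j, columnWeight x (o j) ((Fin.snoc r c : Fin (m + 1) → Option (Fin 4)) j) else 0) =
    if o (Fin.last m) = false → c = none then
      columnWeight x (o (Fin.last m)) c *
        if BlocksRow c then ∏ j : Fin m, (if o j.castSucc then x else 1)
        else rowSum x fun j => o j.castSucc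
    else 0 := by
  simp only [isAdmissibleRow_snoc, Fin.prod_univ_castSucc, Fin.snoc_castSucc, Fin.snoc_last]
  by_cases h : o (Fin.last m) = false → c = none
  · rw [if_pos h]
    by_cases hb : BlocksRow c
    · rw [if_pos hb, Fintype.sum_eq_single (fun _ => none)]
      · rw [if_pos ⟨h, isAdmissibleRow_none _, fun _ => rfl⟩, mul_comm]
        simp [columnWeight]
      · intro r hr
        exact if_neg fun h' => hr (h'.2.2 hb)
    · rw [if_neg hb, rowSum, mul_sum]
      refine sum_congr rfl fun r _ => ?_
      by_cases hr : IsAdmissibleRow (fun j => o j.castSucc) r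
      · rw [if_pos ⟨h, hr, fun h' => absurd h' hb⟩, if_pos hr, mul_comm]
      · rw [if_neg fun h' => hr h'.2.1, if_neg hr, mul_zero]
  · rw [if_neg h]
    exact sum_eq_zero fun r _ => if_neg fun h' => h h'.1

theorem rowSum_add (x : ℕ) {m : ℕ} (o : Fin m → Bool) :
    rowSum x o + x * ∏ j, (if o j then x else 1) = (x + 1) * ∏ j, (if o j then x + 2 else 1) := by
  induction m with
  | zero => simp [rowSum, IsAdmissibleRow, add_comm]
  | succ m ih =>
    have ih := ih fun j => o j.castSucc
    rw [rowSum, sum_snoc]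
    simp only [sum_snoc_admissible]
    simp only [Fin.prod_univ_castSucc]
    cases h : o (Fin.last m) <;>
      simp [Fintype.sum_option, Fin.sum_univ_four, columnWeight, BlocksRow]
    · exact ih
    · linear_combination (x + 2) * ih

/-- The columns of `T` containing neither `α` nor `γ`. -/
def isOpenColumn {n : ℕ} (T : Fin n → Fin n → Option (Fin 4)) (j : Fin n) : Bool :=
  decide (∀ i, ¬ BlocksColumn (T i j))

/-- The rows that can be placed on top of a tableau with open columns `o`. -/
def IsTopRow {m : ℕ} (o : Fin m → Bool) (r : Fin (m + 1) → Option (Fin 4)) : Prop :=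
  IsAdmissibleRow (Fin.snoc o true : Fin (m + 1) → Bool) r ∧ r (Fin.last m) ≠ none

instance {m : ℕ} (o : Fin m → Bool) : DecidablePred (IsTopRow o) := fun _ =>
  @instDecidableAnd _ _ inferInstance inferInstance

theorem sum_topRow (x : ℕ) {m : ℕ} (o : Fin m → Bool) :
    ∑ r : {r // IsTopRow o r},
      ∏ j, columnWeight x ((Fin.snoc o true : Fin (m + 1) → Bool) j) (r.1 j) =
    2 * (x + 1) * ∏ j, (if o j then x + 2 else 1) := by
  have key : ∑ r : {r // IsTopRow o r},
      ∏ j, columnWeight x ((Fin.snoc o true : Fin (m + 1) → Bool) j) (r.1 j) =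
      ∑ r, if r (Fin.last m) ≠ none then
        (if IsAdmissibleRow (Fin.snoc o true : Fin (m + 1) → Bool) r then
          ∏ j, columnWeight x ((Fin.snoc o true : Fin (m + 1) → Bool) j) (r j) else 0) else 0 := by
    rw [← sum_subtype (univ.filter (IsTopRow o)) (by simp)
      (fun r => ∏ j, columnWeight x ((Fin.snoc o true : Fin (m + 1) → Bool) j) (r j)), sum_filter]
    refine sum_congr rfl fun r _ => ?_
    rw [← ite_and]
    exact if_congr and_comm rfl rfl
  rw [key, sum_snoc]
  simp only [Fin.snoc_last, sum_ite_irrel, sum_snoc_admissible]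
  have := rowSum_add x o
  simp [Fintype.sum_option, Fin.sum_univ_four, columnWeight, BlocksRow]
  linear_combination 2 * this

/-- Put the row `r` on top of `T`. -/
def addTopRow {n : ℕ} (T : Fin n → Fin n → Option (Fin 4)) (r : Fin (n + 1) → Option (Fin 4)) :
    Fin (n + 1) → Fin (n + 1) → Option (Fin 4) :=
  Fin.snoc (fun i => Fin.snoc (T i) none) r

/-- Remove the top row (and the last column). -/
def removeTopRow {n : ℕ} (T : Fin (n + 1) → Fin (n + 1) → Option (Fin 4)) :
    Fin n → Fin n → Option (Fin 4) :=
  fun i j => T i.castSucc j.castSucc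

theorem isOpenColumn_addTopRow {n : ℕ} (T : Fin n → Fin n → Option (Fin 4))
    (r : Fin (n + 1) → Option (Fin 4)) (j : Fin (n + 1)) :
    isOpenColumn (addTopRow T r) j =
      ((Fin.snoc (isOpenColumn T) true : Fin (n + 1) → Bool) j && !decide (BlocksColumn (r j))) := by
  induction j using Fin.lastCases <;>
    simp [isOpenColumn, addTopRow, Fin.forall_fin_succ', BlocksColumn]

theorem isStaircase_addTopRow_iff {n : ℕ} (T : Fin n → Fin n → Option (Fin 4))
    (r : Fin (n + 1) → Option (Fin 4)) :
    IsStaircase (n + 1) (addTopRow T r) ↔ IsStaircase n T ∧ IsTopRow (isOpenColumn T) r := by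
  simp only [IsStaircase, IsTopRow, IsAdmissibleRow, addTopRow, Fin.forall_fin_succ',
    Fin.snoc_castSucc, Fin.snoc_last, isOpenColumn]
  simp [Fin.castSucc_lt_last, Fin.le_last, (Fin.castSucc_lt_last _).not_gt, BlocksColumn, BlocksRow]
  constructor
  · rintro ⟨h₁, ⟨h₂, h₃⟩, h₄, h₅, h₆, h₇⟩
    refine ⟨⟨h₁, h₂, fun i j i' => (h₄ i j).1 i', h₅⟩, ⟨fun j i h => ?_, h₆, h₇⟩, h₃⟩
    rcases lt_or_ge i j with hij | hij
    · simp [h₁ i j hij] at h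
    · exact (h₄ i j).2 hij (or_iff_not_imp_left.2 h)
  · rintro ⟨⟨h₁, h₂, h₃, h₄⟩, ⟨h₅, h₆, h₇⟩, h₈⟩
    exact ⟨h₁, ⟨h₂, h₈⟩, fun i j => ⟨fun i' => h₃ i j i',
      fun _ h => h₅ j i (or_iff_not_imp_left.1 h)⟩, h₄, h₆, h₇⟩

theorem addTopRow_removeTopRow {n : ℕ} {T : Fin (n + 1) → Fin (n + 1) → Option (Fin 4)}
    (hT : IsStaircase (n + 1) T) : addTopRow (removeTopRow T) (T (Fin.last n)) = T := by
  ext1 i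
  induction i using Fin.lastCases with
  | last => simp [addTopRow]
  | cast i =>
    ext1 j
    induction j using Fin.lastCases with
    | last => simpa [addTopRow] using (hT.1 _ _ (Fin.castSucc_lt_last i)).symm
    | cast j => simp [addTopRow, removeTopRow]

theorem removeTopRow_addTopRow {n : ℕ} (T : Fin n → Fin n → Option (Fin 4))
    (r : Fin (n + 1) → Option (Fin 4)) : removeTopRow (addTopRow T r) = T := by
  ext1 i
  ext1 j
  simp [addTopRow, removeTopRow]

theorem addTopRow_last {n : ℕ} (T : Fin n → Fin n → Option (Fin 4))
    (r : Fin (n + 1) → Option (Fin 4)) : addTopRow T r (Fin.last n) = r := by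
  simp [addTopRow]

/-- A tableau of size `n + 1` is a tableau of size `n` together with a top row. -/
def topRowEquiv (n : ℕ) :
    (Σ T : StaircaseTableau n, {r // IsTopRow (isOpenColumn T.1) r}) ≃ StaircaseTableau (n + 1) where
  toFun p := ⟨addTopRow p.1.1 p.2.1, (isStaircase_addTopRow_iff _ _).2 ⟨p.1.2, p.2.2⟩⟩
  invFun T :=
    have h := (isStaircase_addTopRow_iff (removeTopRow T.1) (T.1 (Fin.last n))).1
      ((addTopRow_removeTopRow T.2).symm ▸ T.2)
    ⟨⟨removeTopRow T.1, h.1⟩, ⟨T.1 (Fin.last n), h.2⟩⟩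
  left_inv := by
    rintro ⟨⟨T, hT⟩, ⟨r, hr⟩⟩
    exact Sigma.subtype_ext (Subtype.ext (removeTopRow_addTopRow T r)) (addTopRow_last T r)
  right_inv T := Subtype.ext (addTopRow_removeTopRow T.2)

/-- The generating function of staircase tableaux by their number of open columns. -/
def openColumnSum (n x : ℕ) : ℕ :=
  ∑ T : StaircaseTableau n, ∏ j, if isOpenColumn T.1 j then x else 1

theorem openColumnSum_succ (n x : ℕ) :
    openColumnSum (n + 1) x = 2 * (x + 1) * openColumnSum n (x + 2) := by
  rw [openColumnSum, ← (topRowEquiv n).sum_comp, Fintype.sum_sigma, openColumnSum, mul_sum]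
  refine sum_congr rfl fun T _ => ?_
  rw [← sum_topRow]
  refine sum_congr rfl fun r _ => prod_congr rfl fun j _ => ?_
  rw [show (topRowEquiv n ⟨T, r⟩).1 = addTopRow T.1 r.1 from rfl, isOpenColumn_addTopRow]
  simp [columnWeight]

theorem openColumnSum_eq (n x : ℕ) :
    openColumnSum n x = 2 ^ n * ∏ i ∈ range n, (x + 2 * i + 1) := by
  induction n generalizing x with
  | zero =>
    have : IsStaircase 0 default := by simp [IsStaircase]
    have : Unique (StaircaseTableau 0) :=
      ⟨⟨⟨default, this⟩⟩, fun T => Subtype.ext (Subsingleton.elim _ _)⟩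
    rw [openColumnSum, Fintype.sum_unique]
    simp
  | succ n ih =>
    rw [openColumnSum_succ, ih, prod_range_succ']
    have : ∀ i, x + 2 * (i + 1) + 1 = x + 2 + 2 * i + 1 := fun i => by ring
    simp only [this]
    ring

theorem card_staircaseTableau (n : ℕ) :
    Nat.card (StaircaseTableau n) = 2 ^ n * ∏ i ∈ range n, (1 + 2 * i + 1) := by
  rw [← openColumnSum_eq, Nat.card_eq_fintype_card]
  simp [openColumnSum]

/-- the number of staircase tableaux of size `n+1` equals `4(n+1)` times the
number of staircase tableaux of size `n`. -/
theorem statement13 (n : ℕ) :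
    Nat.card (StaircaseTableau (n + 1)) = 4 * (n + 1) * Nat.card (StaircaseTableau n) := by
  rw [card_staircaseTableau, card_staircaseTableau, prod_range_succ]
  ring
end
end

section
/- For every n ≥ 0, the number of type B staircase tableaux of size n+1 equals 4·(2n+1) times the number of type B staircase tableaux of size n. -/
open MvPolynomial Finset

noncomputable section

/-- A staircase tableau of size `2n` is fixed by the involution `ψ` when the entry of each
cell `(i,j)` equals the entry of the cell `(2n+1−j, 2n+1−i)` (in the `1`-based numbering,
i.e. `(Fin.rev j, Fin.rev i)` here) with `α ↔ δ` and `β ↔ γ` exchanged (the exchange of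
symbols is `Fin.rev` on `Fin 4`). -/
def IsTypeB (n : ℕ) (T : Fin (2 * n) → Fin (2 * n) → Option (Fin 4)) : Prop :=
  ∀ i j : Fin (2 * n), T i j = Option.map Fin.rev (T j.rev i.rev)

instance (n : ℕ) (T : Fin (2 * n) → Fin (2 * n) → Option (Fin 4)) :
    Decidable (IsTypeB n T) := by
  unfold IsTypeB; infer_instance

/-- The type of type `B` staircase tableaux of size `n`: staircase tableaux of size `2n`
fixed by the involution `ψ`. -/
def TypeBTableau (n : ℕ) : Type := {T : StaircaseTableau (2 * n) // IsTypeB n T.1}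

instance (n : ℕ) : Fintype (TypeBTableau n) := Subtype.fintype _

section

open scoped Classical

/-- The labels `α` and `γ`, which force the cells above them to be empty. -/
def IsUp (a : Option (Fin 4)) : Prop := a = some 0 ∨ a = some 2

/-- The labels `β` and `δ`, which force the cells to their left to be empty. -/
def IsLeft (a : Option (Fin 4)) : Prop := a = some 1 ∨ a = some 3

@[simp] lemma not_isUp_none : ¬ IsUp none := by simp [IsUp]

@[simp] lemma not_isLeft_none : ¬ IsLeft none := by simp [IsLeft]

lemma isUp_isLeft_labels :
    (IsUp (some 0) ∧ ¬ IsUp (some 1) ∧ IsUp (some 2) ∧ ¬ IsUp (some 3)) ∧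
      ¬ IsLeft (some 0) ∧ IsLeft (some 1) ∧ ¬ IsLeft (some 2) ∧ IsLeft (some 3) := by
  simp [IsUp, IsLeft]

@[simp] lemma isUp_map_rev (a : Option (Fin 4)) : IsUp (a.map Fin.rev) ↔ IsLeft a := by
  unfold IsUp IsLeft; revert a; decide

@[simp] lemma isLeft_map_rev (a : Option (Fin 4)) : IsLeft (a.map Fin.rev) ↔ IsUp a := by
  unfold IsUp IsLeft; revert a; decide

lemma map_rev_map_rev (a : Option (Fin 4)) : (a.map Fin.rev).map Fin.rev = a := by
  revert a; decide

/-- Staircase tableaux of any size `N` that are fixed by the involution. -/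
structure IsSymStaircase (N : ℕ) (T : Fin N → Fin N → Option (Fin 4)) : Prop where
  upper : ∀ i j, i < j → T i j = none
  diag : ∀ i, T i i ≠ none
  col : ∀ i j i', i < i' → IsUp (T i j) → T i' j = none
  symm : ∀ i j, T i j = (T j.rev i.rev).map Fin.rev

lemma isSymStaircase_iff {N : ℕ} {T : Fin N → Fin N → Option (Fin 4)} :
    IsSymStaircase N T ↔
      IsStaircase N T ∧ ∀ i j, T i j = (T j.rev i.rev).map Fin.rev := by
  constructor
  · intro h
    refine ⟨⟨h.upper, h.diag, fun i j i' _ hi => h.col i j i' hi, ?_⟩, h.symm⟩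
    intro i j j' hj _ hT
    have hup : IsUp (T j.rev i.rev) := by
      rw [h.symm, Fin.rev_rev, Fin.rev_rev, isUp_map_rev]; exact hT
    rw [h.symm, h.col _ _ _ (Fin.rev_lt_rev.2 hj) hup]; rfl
  · rintro ⟨⟨h1, h2, h3, -⟩, h5⟩
    refine ⟨h1, h2, fun i j i' hi hT => ?_, h5⟩
    rcases le_or_gt j i with hji | hij
    · exact h3 i j i' hji hi hT
    · rw [h1 i j hij] at hT
      exact absurd hT not_isUp_none

/-- The row of a cell is blocked when it contains a `β` or a `δ`. -/
def Blocked {N : ℕ} (T : Fin N → Fin N → Option (Fin 4)) (i : Fin N) : Prop :=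
  ∃ j, IsLeft (T i j)

/-- Enumeration of the symmetric tableaux, each unblocked row having weight `x`. -/
def symSum (N x : ℕ) : ℕ :=
  ∑ T : Fin N → Fin N → Option (Fin 4) with IsSymStaircase N T,
    ∏ i, if Blocked T i then 1 else x

/-- Fillings `c` of a new leftmost column (without its bottom cell), `b` being the set of
blocked rows. -/
def ValidCol {m : ℕ} (b : Fin m → Prop) (c : Fin m → Option (Fin 4)) : Prop :=
  (∀ k, b k → c k = none) ∧ ∀ k k', k < k' → IsUp (c k) → c k' = none

lemma validCol_cons {m : ℕ} (b : Fin (m + 1) → Prop) (a : Option (Fin 4))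
    (c : Fin m → Option (Fin 4)) :
    ValidCol b (Fin.cons a c : Fin (m + 1) → Option (Fin 4)) ↔
      (b 0 → a = none) ∧ (IsUp a → c = fun _ => none) ∧ ValidCol (fun k => b k.succ) c := by
  simp only [ValidCol, Fin.forall_fin_succ, Fin.cons_zero, Fin.cons_succ, Fin.succ_lt_succ_iff,
    Fin.succ_pos, Fin.not_lt_zero, funext_iff, false_imp_iff, true_and,
    forall_const]
  tauto

lemma sum_fin_succ_fun {m : ℕ} {A : Type*} [Fintype A] (f : (Fin (m + 1) → A) → ℕ) :
    ∑ c, f c = ∑ a, ∑ c : Fin m → A, f (Fin.cons a c : Fin (m + 1) → A) := by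
  rw [← Fintype.sum_prod_type', ← (Fin.consEquiv fun _ : Fin (m + 1) => A).sum_comp]
  rfl

lemma validCol_none {m : ℕ} (b : Fin m → Prop) : ValidCol b fun _ => none := by
  simp [ValidCol]

lemma sum_validCol_eq_none {m : ℕ} (x y : ℕ) (b : Fin m → Prop) :
    (∑ c : Fin m → Option (Fin 4), if (c = fun _ => none) ∧ ValidCol b c then
      y * ∏ k, (if b k ∨ IsLeft (c k) then 1 else x) else 0) =
      y * ∏ k, if b k then 1 else x := by
  rw [Finset.sum_eq_single fun _ => none]
  · simp [validCol_none]
  · intro c _ hc; simp [hc]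
  · simp

/-- The weight of a column filling: `x` for each row left unblocked, including the new top row
obtained by reflecting the column. -/
def colWeight {m : ℕ} (x : ℕ) (b : Fin m → Prop) (c : Fin m → Option (Fin 4)) : ℕ :=
  (∏ k, if b k ∨ IsLeft (c k) then 1 else x) * if ∃ k, IsUp (c k) then 1 else x

lemma sum_colWeight {m : ℕ} (x : ℕ) (b : Fin m → Prop) :
    (∑ c with ValidCol b c, colWeight x b c) + x * ∏ k, (if b k then 1 else x) =
      2 * x * ∏ k, if b k then 1 else x + 2 := by
  induction m with
  | zero =>
    simp [ValidCol, colWeight]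
    ring
  | succ m ih =>
    have ih := ih fun k => b k.succ
    have key : ∀ y : ℕ, (∑ c : Fin m → Option (Fin 4),
        if (c = fun _ => none) ∧ ValidCol (fun k => b k.succ) c then
          y * ∏ k : Fin m, (if b k.succ ∨ IsLeft (c k) then 1 else x) else 0) =
        y * ∏ k : Fin m, (if b k.succ then 1 else x) := by
      intro y
      rw [Finset.sum_eq_single fun _ => none]
      · simp [validCol_none]
      · intro c _ hc; simp [hc]
      · simp
    rw [Finset.sum_filter, sum_fin_succ_fun, Fintype.sum_option, Fin.sum_univ_four]
    simp only [validCol_cons, colWeight, Fin.prod_univ_succ, Fin.exists_fin_succ, Fin.cons_zero,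
      Fin.cons_succ, isUp_isLeft_labels, not_isUp_none, not_isLeft_none]
    rw [Finset.sum_filter] at ih
    simp only [colWeight] at ih
    by_cases hb : b 0
    · simpa [hb] using ih
    · simp only [hb, false_or, true_or, if_true, if_false, true_and, forall_true_left,
        false_imp_iff, or_false, mul_one, one_mul, sum_validCol_eq_none, reduceCtorEq]
      have hsum : ∀ y : ℕ, (∑ c : Fin m → Option (Fin 4), if ValidCol (fun k => b k.succ) c then
          y * (∏ k : Fin m, (if b k.succ ∨ IsLeft (c k) then 1 else x)) *
            (if ∃ k, IsUp (c k) then 1 else x) else 0) = y * ∑ c, if ValidCol (fun k => b k.succ) c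
          then (∏ k : Fin m, (if b k.succ ∨ IsLeft (c k) then 1 else x)) *
            (if ∃ k, IsUp (c k) then 1 else x) else 0 := by
        intro y
        simp only [Finset.mul_sum, mul_ite_zero, mul_assoc]
      rw [hsum]
      linear_combination (x + 2) * ih

/-- Add a leftmost column with entries `some a`, `c`, `none` to `T`, and the top row obtained by
reflecting it. -/
def extend {N : ℕ} (T : Fin N → Fin N → Option (Fin 4)) (a : Fin 4)
    (c : Fin N → Option (Fin 4)) : Fin (N + 2) → Fin (N + 2) → Option (Fin 4) :=
  Fin.cons (Fin.cons (some a) fun _ => none)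
    (Fin.snoc (α := fun _ => Fin (N + 2) → Option (Fin 4))
      (fun k => Fin.cons (c k) (Fin.snoc (α := fun _ => Option (Fin 4)) (T k) none))
      (Fin.cons none (Fin.snoc (α := fun _ => Option (Fin 4))
        (fun l => (c l.rev).map Fin.rev) (some a.rev))))

section extend

variable {N : ℕ} (T : Fin N → Fin N → Option (Fin 4)) (a : Fin 4) (c : Fin N → Option (Fin 4))

@[simp] lemma extend_zero_zero : extend T a c 0 0 = some a := rfl

@[simp] lemma extend_zero_succ (j : Fin (N + 1)) : extend T a c 0 j.succ = none := rfl

@[simp] lemma extend_mid_zero (k : Fin N) : extend T a c k.castSucc.succ 0 = c k := by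
  simp [extend]

@[simp] lemma extend_mid_mid (k l : Fin N) :
    extend T a c k.castSucc.succ l.castSucc.succ = T k l := by
  simp [extend]

@[simp] lemma extend_mid_last (k : Fin N) :
    extend T a c k.castSucc.succ (Fin.last N).succ = none := by
  simp only [extend, Fin.cons_succ, Fin.snoc_castSucc, Fin.snoc_last]

@[simp] lemma extend_last_zero : extend T a c (Fin.last N).succ 0 = none := by
  simp only [extend, Fin.cons_succ, Fin.snoc_last, Fin.cons_zero]

@[simp] lemma extend_last_mid (l : Fin N) :
    extend T a c (Fin.last N).succ l.castSucc.succ = (c l.rev).map Fin.rev := by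
  simp only [extend, Fin.cons_succ, Fin.snoc_castSucc, Fin.snoc_last]

@[simp] lemma extend_last_last :
    extend T a c (Fin.last N).succ (Fin.last N).succ = some a.rev := by
  simp only [extend, Fin.cons_succ, Fin.snoc_last]

end extend

lemma forall_fin_add_two {N : ℕ} {P : Fin (N + 2) → Prop} :
    (∀ i, P i) ↔ P 0 ∧ (∀ k : Fin N, P k.castSucc.succ) ∧ P (Fin.last N).succ := by
  rw [Fin.forall_fin_succ, Fin.forall_fin_succ']

lemma exists_fin_add_two {N : ℕ} {P : Fin (N + 2) → Prop} :
    (∃ i, P i) ↔ P 0 ∨ (∃ k : Fin N, P k.castSucc.succ) ∨ P (Fin.last N).succ := by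
  rw [Fin.exists_fin_succ, Fin.exists_fin_succ']

lemma rev_zero_add_two (N : ℕ) : (0 : Fin (N + 2)).rev = (Fin.last N).succ := by
  simp

lemma rev_mid {N : ℕ} (k : Fin N) : k.castSucc.succ.rev = k.rev.castSucc.succ := by
  rw [Fin.rev_succ, Fin.rev_castSucc, Fin.succ_castSucc]

lemma rev_last_succ (N : ℕ) : (Fin.last N).succ.rev = 0 := by
  simp

lemma mid_lt_last_succ {N : ℕ} (k : Fin N) : k.castSucc.succ < (Fin.last N).succ :=
  Fin.succ_lt_succ_iff.2 k.castSucc_lt_last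

lemma isSymStaircase_extend {N : ℕ} {T : Fin N → Fin N → Option (Fin 4)} {a : Fin 4}
    {c : Fin N → Option (Fin 4)} :
    IsSymStaircase (N + 2) (extend T a c) ↔
      IsSymStaircase N T ∧ (IsUp (some a) → c = fun _ => none) ∧ ValidCol (Blocked T) c := by
  constructor
  · intro h
    have hT : IsSymStaircase N T := by
      refine ⟨fun i j hij => ?_, fun i => ?_, fun i j i' hi hT => ?_, fun i j => ?_⟩
      · simpa using h.upper i.castSucc.succ j.castSucc.succ (by simpa using hij)
      · simpa using h.diag i.castSucc.succ
      · simpa using h.col i.castSucc.succ j.castSucc.succ i'.castSucc.succ (by simpa using hi)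
          (by simpa using hT)
      · simpa only [rev_mid, extend_mid_mid] using h.symm i.castSucc.succ j.castSucc.succ
    refine ⟨hT, fun ha => funext fun k => ?_, ?_, fun k k' hk hc => ?_⟩
    · simpa using h.col 0 0 k.castSucc.succ (Fin.succ_pos _) (by simpa using ha)
    · rintro k ⟨l, hl⟩
      have hup : IsUp (T l.rev k.rev) := by
        rw [hT.symm, Fin.rev_rev, Fin.rev_rev, isUp_map_rev]; exact hl
      simpa [-Fin.succ_last] using h.col l.rev.castSucc.succ k.rev.castSucc.succ (Fin.last N).succ
        (mid_lt_last_succ _) (by simpa using hup)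
    · simpa using h.col k.castSucc.succ 0 k'.castSucc.succ (by simpa using hk) (by simpa using hc)
  · rintro ⟨hT, ha, hb, hc⟩
    have hlast : ∀ k l, IsUp (T k l) → c l.rev = none := fun k l h =>
      hb _ ⟨k.rev, by rwa [hT.symm, Fin.rev_rev, Fin.rev_rev, isLeft_map_rev]⟩
    constructor
    · simp only [forall_fin_add_two]
      simpa [-Fin.succ_last, mid_lt_last_succ, (mid_lt_last_succ _).not_gt] using hT.upper
    · simp only [forall_fin_add_two]
      simpa [-Fin.succ_last] using hT.diag
    · simp only [forall_fin_add_two]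
      simp [-Fin.succ_last, (mid_lt_last_succ _).not_gt]
      exact ⟨fun k h => congrFun (ha h) k, fun k => ⟨hc k, fun l =>
        ⟨fun k' => hT.col k l k', hlast k l⟩⟩⟩
    · simp only [forall_fin_add_two, rev_zero_add_two, rev_mid, rev_last_succ]
      simp [-Fin.succ_last, -Option.map_map, map_rev_map_rev]
      exact hT.symm

lemma exists_extend_eq {N : ℕ} {S : Fin (N + 2) → Fin (N + 2) → Option (Fin 4)}
    (h : IsSymStaircase (N + 2) S) : ∃ T a c, extend T a c = S := by
  obtain ⟨a, ha⟩ := Option.ne_none_iff_exists'.1 (h.diag 0)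
  have hcorner : S (Fin.last N).succ 0 = none := by
    have := h.symm (Fin.last N).succ 0
    rw [rev_zero_add_two, rev_last_succ] at this
    revert this
    generalize S (Fin.last N).succ 0 = s
    revert s
    decide
  refine ⟨fun k l => S k.castSucc.succ l.castSucc.succ, a, fun k => S k.castSucc.succ 0, ?_⟩
  suffices H : ∀ i j, extend _ _ _ i j = S i j from funext fun i => funext (H i)
  simp only [forall_fin_add_two]
  refine ⟨⟨?_, fun l => ?_, ?_⟩, fun k => ⟨?_, fun l => ?_, ?_⟩, ?_, fun l => ?_, ?_⟩
  · simp [ha]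
  · simp [h.upper 0 l.castSucc.succ (Fin.succ_pos _)]
  · simp [-Fin.succ_last, h.upper 0 (Fin.last N).succ (Fin.succ_pos _)]
  · simp
  · simp
  · rw [h.upper k.castSucc.succ (Fin.last N).succ (mid_lt_last_succ k)]
    simp [-Fin.succ_last]
  · rw [hcorner]; simp [-Fin.succ_last]
  · rw [h.symm (Fin.last N).succ l.castSucc.succ, rev_last_succ, rev_mid]
    simp [-Fin.succ_last]
  · rw [h.symm (Fin.last N).succ (Fin.last N).succ, rev_last_succ, ha]
    simp [-Fin.succ_last]

lemma extend_injective {N : ℕ} {T T' : Fin N → Fin N → Option (Fin 4)} {a a' : Fin 4}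
    {c c' : Fin N → Option (Fin 4)} (h : extend T a c = extend T' a' c') :
    T = T' ∧ a = a' ∧ c = c' := by
  refine ⟨funext fun k => funext fun l => ?_, ?_, funext fun k => ?_⟩
  · simpa using congrFun (congrFun h k.castSucc.succ) l.castSucc.succ
  · simpa using congrFun (congrFun h 0) 0
  · simpa using congrFun (congrFun h k.castSucc.succ) 0

lemma weight_extend {N : ℕ} (x : ℕ) (T : Fin N → Fin N → Option (Fin 4)) (a : Fin 4)
    (c : Fin N → Option (Fin 4)) :
    (∏ i, if Blocked (extend T a c) i then 1 else x) =
      (if IsLeft (some a) then 1 else x) * (∏ k, if Blocked T k ∨ IsLeft (c k) then 1 else x) *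
        if IsUp (some a) ∨ ∃ k, IsUp (c k) then 1 else x := by
  have h0 : Blocked (extend T a c) 0 ↔ IsLeft (some a) := by
    simp only [Blocked, Fin.exists_fin_succ, extend_zero_zero, extend_zero_succ]; simp
  have hm : ∀ k, Blocked (extend T a c) (Fin.castSucc k).succ ↔
      Blocked T k ∨ IsLeft (c k) := by
    intro k
    simp only [Blocked, exists_fin_add_two, extend_mid_zero, extend_mid_mid, extend_mid_last]
    simp [or_comm]
  have hl : Blocked (extend T a c) (Fin.last N).succ ↔ IsUp (some a) ∨ ∃ k, IsUp (c k) := by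
    simp only [Blocked, exists_fin_add_two, extend_last_zero, extend_last_mid, extend_last_last,
      ← Option.map_some, isLeft_map_rev, not_isLeft_none, false_or]
    rw [or_comm, Fin.rev_surjective.exists (p := fun k => IsUp (c k))]
  simp only [Fin.prod_univ_succ (n := N + 1), Fin.prod_univ_castSucc (n := N), h0, hm, hl,
    mul_assoc]

lemma symSum_add_two (N x : ℕ) : symSum (N + 2) x = 4 * x * symSum N (x + 2) := by
  have hbij : symSum (N + 2) x =
      ∑ p : (Fin N → Fin N → Option (Fin 4)) × Fin 4 × (Fin N → Option (Fin 4)) with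
        IsSymStaircase (N + 2) (extend p.1 p.2.1 p.2.2),
        ∏ i, if Blocked (extend p.1 p.2.1 p.2.2) i then 1 else x := by
    symm
    refine Finset.sum_nbij (fun p => extend p.1 p.2.1 p.2.2) (by simp) ?_ ?_ (fun _ _ => rfl)
    · rintro ⟨T, a, c⟩ _ ⟨T', a', c'⟩ _ h
      obtain ⟨rfl, rfl, rfl⟩ := extend_injective h
      rfl
    · intro S hS
      obtain ⟨T, a, c, rfl⟩ := exists_extend_eq (by simpa using hS)
      exact ⟨(T, a, c), by simpa using hS, rfl⟩
  rw [hbij, symSum, Finset.sum_filter, Fintype.sum_prod_type, Finset.mul_sum, Finset.sum_filter]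
  refine Finset.sum_congr rfl fun T _ => ?_
  by_cases hT : IsSymStaircase N T
  · have hcol := sum_colWeight x (Blocked T)
    simp only [Finset.sum_filter, colWeight] at hcol
    rw [Fintype.sum_prod_type, Fin.sum_univ_four]
    simp only [isSymStaircase_extend, weight_extend, hT, isUp_isLeft_labels,
      true_and, if_true, if_false, true_or, false_or, mul_one, one_mul, forall_true_left,
      false_imp_iff, sum_validCol_eq_none]
    linear_combination 2 * hcol
  · simp [isSymStaircase_extend, hT]

lemma symSum_two_mul (n x : ℕ) :
    symSum (2 * n) x = 4 ^ n * ∏ k ∈ Finset.range n, (x + 2 * k) := by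
  induction n generalizing x with
  | zero =>
    have h : ∀ T, IsSymStaircase (2 * 0) T := fun T =>
      ⟨fun i => i.elim0, fun i => i.elim0, fun i => i.elim0, fun i => i.elim0⟩
    simp [symSum, h]
  | succ n ih =>
    rw [Nat.mul_succ, symSum_add_two, ih, Finset.prod_range_succ']
    have h : ∀ k, x + 2 * (k + 1) = x + 2 + 2 * k := fun k => by ring
    simp only [h]
    ring

lemma card_typeBTableau (n : ℕ) :
    Nat.card (TypeBTableau n) = 4 ^ n * ∏ k ∈ Finset.range n, (1 + 2 * k) := by
  rw [← symSum_two_mul, symSum]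
  simp only [ite_self, Finset.prod_const_one, Finset.sum_const, smul_eq_mul, mul_one]
  rw [← Fintype.card_subtype, ← Nat.card_eq_fintype_card]
  refine Nat.card_congr ((Equiv.subtypeSubtypeEquivSubtypeInter _ _).trans
    (Equiv.subtypeEquivRight fun T => ?_))
  exact isSymStaircase_iff.symm

end

/-- the number of type `B` staircase tableaux of size `n+1` equals `4(2n+1)`
times the number of type `B` staircase tableaux of size `n`. -/
theorem statement15 (n : ℕ) :
    Nat.card (TypeBTableau (n + 1)) = 4 * (2 * n + 1) * Nat.card (TypeBTableau n) := by
  rw [card_typeBTableau, card_typeBTableau, Finset.prod_range_succ]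
  ring
end
end
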